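/- Let R_1, …, R_6 be the six open rays from the origin in ℝ² at angles 0, θ, π−θ, π, π+θ, 2π−θ where cos θ = 1/4, and let V_i be the integral 1-varifolds with ‖V_i‖ = H¹ ⌊ R_i. Then the varifold V = 2(V₁ + V₂ + V₃ + V₄ + V₅ + V₆) is stationary, i.e. δV = 0. -/

import Mathlib

open MeasureTheory Filter Metric Set Topology
open scoped ENNReal RealInnerProductSpace

noncomputable def tdiv (P : Fin 2 → Fin 2 → ℝ)
    (g : EuclideanSpace ℝ (Fin 2) → EuclideanSpace ℝ (Fin 2))
    (x : EuclideanSpace ℝ (Fin 2)) : ℝ :=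
  ∑ i, ∑ j, P i j * fderiv ℝ g x (EuclideanSpace.single i 1) j

noncomputable def fvar
    (V : Measure (EuclideanSpace ℝ (Fin 2) × (Fin 2 → Fin 2 → ℝ)))
    (g : EuclideanSpace ℝ (Fin 2) → EuclideanSpace ℝ (Fin 2)) : ℝ :=
  ∫ p, tdiv p.2 g p.1 ∂V

def IsTest (g : EuclideanSpace ℝ (Fin 2) → EuclideanSpace ℝ (Fin 2)) : Prop :=
  ContDiff ℝ (⊤ : ℕ∞) g ∧ HasCompactSupport g

/-- The six unit directions at angles `0, θ, π−θ, π, π+θ, 2π−θ` with `cos θ = 1/4`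
(so `sin θ = √15/4`). -/
noncomputable def rayDir : Fin 6 → EuclideanSpace ℝ (Fin 2) := fun i =>
  (WithLp.equiv 2 (Fin 2 → ℝ)).symm
    (![![1, 0], ![1/4, Real.sqrt 15 / 4], ![-(1/4), Real.sqrt 15 / 4], ![-1, 0],
        ![-(1/4), -(Real.sqrt 15 / 4)], ![1/4, -(Real.sqrt 15 / 4)]] i)

/-- The open ray from the origin in direction `rayDir i`. -/
def ray (i : Fin 6) : Set (EuclideanSpace ℝ (Fin 2)) :=
  {x | ∃ t : ℝ, 0 < t ∧ x = t • rayDir i}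

/-- The projection matrix onto the line spanned by the unit vector `rayDir i`. -/
noncomputable def rayProj (i : Fin 6) : Fin 2 → Fin 2 → ℝ := fun a b =>
  rayDir i a * rayDir i b

/-- The integral varifold `V = 2(V₁ + ⋯ + V₆)` associated with multiplicity 2 to the
six rays, each carrying `H¹ ⌊ Rᵢ` with its tangent line. -/
noncomputable def Vjunction : Measure (EuclideanSpace ℝ (Fin 2) × (Fin 2 → Fin 2 → ℝ)) :=
  ∑ i : Fin 6, (2 : ℝ≥0∞) •
    (((μH[1] : Measure (EuclideanSpace ℝ (Fin 2))).restrict (ray i)).map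
      fun x => (x, rayProj i))

lemma norm_rayDir (i : Fin 6) : ‖rayDir i‖ = 1 := by
  have h : Real.sqrt 15 ^ 2 = 15 := Real.sq_sqrt (by norm_num)
  rw [EuclideanSpace.norm_eq, Real.sqrt_eq_one]
  fin_cases i <;> simp [rayDir, Fin.sum_univ_two, div_pow, h] <;> norm_num

lemma sum_rayDir : ∑ i, rayDir i = 0 := by
  ext a
  fin_cases a <;> simp [rayDir, Fin.sum_univ_six]

lemma isometry_smul_rayDir (i : Fin 6) : Isometry fun t : ℝ => t • rayDir i :=
  Isometry.of_dist_eq fun s t => by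
    rw [dist_eq_norm, ← sub_smul, norm_smul, norm_rayDir, mul_one, dist_eq_norm]

lemma hausdorffMeasure_restrict_ray (i : Fin 6) :
    (μH[1] : Measure (EuclideanSpace ℝ (Fin 2))).restrict (ray i) =
      (volume.restrict (Ioi (0 : ℝ))).map fun t => t • rayDir i := by
  have hf := isometry_smul_rayDir i
  have he := hf.isClosedEmbedding.measurableEmbedding
  have hray : ray i = (fun t : ℝ => t • rayDir i) '' Ioi 0 := by
    ext x
    simp [ray, eq_comm]
  have hpre : Ioi (0 : ℝ) = (fun t : ℝ => t • rayDir i) ⁻¹' ray i := by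
    rw [hray, preimage_image_eq _ hf.injective]
  rw [hpre, ← he.restrict_map, ← hausdorffMeasure_real,
    hf.map_hausdorffMeasure (Or.inl zero_le_one), Measure.restrict_restrict_of_subset]
  rw [hray]
  exact image_subset_range _ _

lemma tdiv_rayProj (g : EuclideanSpace ℝ (Fin 2) → EuclideanSpace ℝ (Fin 2)) (i : Fin 6)
    (x : EuclideanSpace ℝ (Fin 2)) :
    tdiv (rayProj i) g x = ⟪rayDir i, fderiv ℝ g x (rayDir i)⟫ := by
  have h : rayDir i = rayDir i 0 • EuclideanSpace.single 0 1 +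
      rayDir i 1 • EuclideanSpace.single 1 1 := by
    ext a
    fin_cases a <;> simp
  have h' : fderiv ℝ g x (rayDir i) = rayDir i 0 • fderiv ℝ g x (EuclideanSpace.single 0 1) +
      rayDir i 1 • fderiv ℝ g x (EuclideanSpace.single 1 1) := by
    conv_lhs => rw [h]
    rw [map_add, map_smul, map_smul]
  rw [h']
  simp only [tdiv, rayProj, Fin.sum_univ_two, PiLp.inner_apply, PiLp.add_apply, PiLp.smul_apply,
    smul_eq_mul, RCLike.inner_apply, conj_trivial]
  ring

lemma continuous_tdiv {g : EuclideanSpace ℝ (Fin 2) → EuclideanSpace ℝ (Fin 2)}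
    (hg : ContDiff ℝ 1 g) :
    Continuous fun p : EuclideanSpace ℝ (Fin 2) × (Fin 2 → Fin 2 → ℝ) => tdiv p.2 g p.1 := by
  have h := hg.continuous_fderiv one_ne_zero
  unfold tdiv
  fun_prop

lemma hasDerivAt_inner_comp_ray {g : EuclideanSpace ℝ (Fin 2) → EuclideanSpace ℝ (Fin 2)}
    (hg : ContDiff ℝ 1 g) (i : Fin 6) (t : ℝ) :
    HasDerivAt (fun t : ℝ => ⟪rayDir i, g (t • rayDir i)⟫)
      (tdiv (rayProj i) g (t • rayDir i)) t := by
  have h1 : HasDerivAt (fun t : ℝ => t • rayDir i) (rayDir i) t := by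
    simpa using (hasDerivAt_id t).smul_const (rayDir i)
  have h2 := ((hg.differentiable one_ne_zero).differentiableAt
    (x := t • rayDir i)).hasFDerivAt.comp_hasDerivAt t h1
  rw [tdiv_rayProj]
  simpa using (hasDerivAt_const t (rayDir i)).inner ℝ h2

lemma hasCompactSupport_tdiv_ray {g : EuclideanSpace ℝ (Fin 2) → EuclideanSpace ℝ (Fin 2)}
    (hc : HasCompactSupport g) (i : Fin 6) :
    HasCompactSupport fun t : ℝ => tdiv (rayProj i) g (t • rayDir i) := by
  simp only [tdiv_rayProj]
  have h : HasCompactSupport fun x => ⟪rayDir i, fderiv ℝ g x (rayDir i)⟫ :=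
    (hc.fderiv_apply ℝ (rayDir i)).comp_left (g := fun v => ⟪rayDir i, v⟫) (by simp)
  exact h.comp_isClosedEmbedding (isometry_smul_rayDir i).isClosedEmbedding

lemma integral_tdiv_ray {g : EuclideanSpace ℝ (Fin 2) → EuclideanSpace ℝ (Fin 2)}
    (hg : ContDiff ℝ 1 g) (hc : HasCompactSupport g) (i : Fin 6) :
    ∫ t in Ioi (0 : ℝ), tdiv (rayProj i) g (t • rayDir i) = -⟪rayDir i, g 0⟫ := by
  have hd := hasDerivAt_inner_comp_ray hg i
  have hcont : Continuous fun t : ℝ => tdiv (rayProj i) g (t • rayDir i) :=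
    (continuous_tdiv hg).comp (f := fun t : ℝ => (t • rayDir i, rayProj i)) (by fun_prop)
  have hderiv : deriv (fun t : ℝ => ⟪rayDir i, g (t • rayDir i)⟫) =
      fun t => tdiv (rayProj i) g (t • rayDir i) := funext fun t => (hd t).deriv
  have hsupp : HasCompactSupport fun t : ℝ => ⟪rayDir i, g (t • rayDir i)⟫ :=
    (hc.comp_left (g := fun v => ⟪rayDir i, v⟫) (by simp)).comp_isClosedEmbedding
      (isometry_smul_rayDir i).isClosedEmbedding
  have h := hsupp.integral_Ioi_deriv_eq (contDiff_one_iff_deriv.2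
    ⟨fun t => (hd t).differentiableAt, hderiv ▸ hcont⟩) 0
  simpa [hderiv] using h

lemma Vjunction_eq_sum_map : Vjunction = ∑ i : Fin 6, (2 : ℝ≥0∞) •
    (volume.restrict (Ioi (0 : ℝ))).map fun t => (t • rayDir i, rayProj i) := by
  refine Finset.sum_congr rfl fun i _ => ?_
  rw [hausdorffMeasure_restrict_ray, Measure.map_map (by fun_prop) (by fun_prop)]
  rfl

/-- The varifold `V = 2(V₁ + ⋯ + V₆)` built on the six rays with `cos θ = 1/4` is
stationary: `δV = 0`. -/
theorem junction_varifold_is_stationary :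
    ∀ g, IsTest g → fvar Vjunction g = 0 := by
  rintro g ⟨hsmooth, hc⟩
  have hg : ContDiff ℝ 1 g := hsmooth.of_le (by exact_mod_cast le_top)
  have hmeas (i : Fin 6) : AEMeasurable (fun t : ℝ => (t • rayDir i, rayProj i))
      (volume.restrict (Ioi (0 : ℝ))) := by fun_prop
  have hF := continuous_tdiv hg
  have hint (i : Fin 6) : Integrable
      (fun p : EuclideanSpace ℝ (Fin 2) × (Fin 2 → Fin 2 → ℝ) => tdiv p.2 g p.1)
      ((volume.restrict (Ioi (0 : ℝ))).map fun t => (t • rayDir i, rayProj i)) := by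
    rw [integrable_map_measure hF.aestronglyMeasurable (hmeas i)]
    exact ((hF.comp (f := fun t : ℝ => (t • rayDir i, rayProj i)) (by fun_prop)
      ).integrable_of_hasCompactSupport (hasCompactSupport_tdiv_ray hc i)).integrableOn
  rw [fvar, Vjunction_eq_sum_map, integral_finsetSum_measure
    fun i _ => (hint i).smul_measure ENNReal.ofNat_ne_top]
  have hterm (i : Fin 6) : ∫ p, tdiv p.2 g p.1 ∂((2 : ℝ≥0∞) •
      (volume.restrict (Ioi (0 : ℝ))).map fun t => (t • rayDir i, rayProj i)) =
      -2 * ⟪rayDir i, g 0⟫ := by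
    rw [integral_smul_measure, integral_map (hmeas i) hF.aestronglyMeasurable,
      integral_tdiv_ray hg hc]
    simp
  simp_rw [hterm]
  rw [← Finset.mul_sum, ← sum_inner, sum_rayDir, inner_zero_left, mul_zero]
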